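/- Let f : [0,1]^n → ℝ_{≥0} be a measurable function with ∫_{[0,1]^n} f(x) dx = 1 that is symmetric under coordinate permutations, i.e. f(x) = f((x_{π(i)})_{i∈N}) for all x ∈ [0,1]^n and all permutations π of N. Then the power index Ψ^f defined by Ψ^f_i(v) = (1/n!) Σ_{π∈S_n} ∫_{[0,1]^n} f(x)·([v(x_{π_{<i}}, 1_{π_{≥i}}) − v(x_{π_{<i}}, 0_{π_{≥i}})] − [v(x_{π_{≤i}}, 1_{π_{>i}}) − v(x_{π_{≤i}}, 0_{π_{>i}})]) dx is positive, efficient, anonymous, symmetric, and satisfies both the null player property and the transfer property on interval simple games. -/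

import Mathlib

open MeasureTheory

/-- The unit cube `[0,1]^n`. -/
def cube (n : ℕ) : Set (Fin n → ℝ) := {x | ∀ i, x i ∈ Set.Icc (0 : ℝ) 1}

/-- An interval simple game: a function `[0,1]^n → [0,1]` with `v(0)=0`, `v(1)=1`,
monotone on the cube. -/
def IsISG (n : ℕ) (v : (Fin n → ℝ) → ℝ) : Prop :=
  v (fun _ => 0) = 0 ∧ v (fun _ => 1) = 1 ∧
  (∀ x ∈ cube n, v x ∈ Set.Icc (0 : ℝ) 1) ∧
  (∀ x ∈ cube n, ∀ y ∈ cube n, (∀ i, x i ≤ y i) → v x ≤ v y)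

/-- The Shapley–Shubik index `Ψ` for interval simple games. -/
noncomputable def Psi (n : ℕ) (v : (Fin n → ℝ) → ℝ) (i : Fin n) : ℝ :=
  (1 / (n.factorial : ℝ)) * ∑ π : Equiv.Perm (Fin n),
    ∫ x in cube n,
      ((v (fun j => if π j < π i then x j else 1) -
        v (fun j => if π j < π i then x j else 0)) -
       (v (fun j => if π j ≤ π i then x j else 1) -
        v (fun j => if π j ≤ π i then x j else 0)))

/-- Player `i` is a null player in `v`: the value does not depend on coordinate `i`. -/
def NullPlayer (n : ℕ) (v : (Fin n → ℝ) → ℝ) (i : Fin n) : Prop :=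
  ∀ x ∈ cube n, ∀ y ∈ cube n, (∀ j, j ≠ i → x j = y j) → v x = v y

/-- Players `i` and `j` are symmetric in `v`. -/
def SymPlayers (n : ℕ) (v : (Fin n → ℝ) → ℝ) (i j : Fin n) : Prop :=
  ∀ x ∈ cube n, v (fun k => x (Equiv.swap i j k)) = v x

/-- Efficiency of a power index. -/
def Efficient (n : ℕ) (Φ : ((Fin n → ℝ) → ℝ) → Fin n → ℝ) : Prop :=
  ∀ v, IsISG n v → ∑ i, Φ v i = 1

/-- Positivity of a power index. -/
def Positive (n : ℕ) (Φ : ((Fin n → ℝ) → ℝ) → Fin n → ℝ) : Prop :=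
  ∀ v, IsISG n v → Φ v ≠ 0 ∧ ∀ i, 0 ≤ Φ v i

/-- Anonymity of a power index: `Φ_{π(i)}(πv) = Φ_i(v)` where `(πv)(x) = v(x ∘ π)`. -/
def Anonymous (n : ℕ) (Φ : ((Fin n → ℝ) → ℝ) → Fin n → ℝ) : Prop :=
  ∀ v, IsISG n v → ∀ π : Equiv.Perm (Fin n), ∀ i : Fin n,
    Φ (fun x => v (fun j => x (π j))) (π i) = Φ v i

/-- Symmetry of a power index: symmetric players obtain the same value. -/
def SymmetricIdx (n : ℕ) (Φ : ((Fin n → ℝ) → ℝ) → Fin n → ℝ) : Prop :=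
  ∀ v, IsISG n v → ∀ i j : Fin n, SymPlayers n v i j → Φ v i = Φ v j

/-- The null player property of a power index. -/
def NullPlayerProp (n : ℕ) (Φ : ((Fin n → ℝ) → ℝ) → Fin n → ℝ) : Prop :=
  ∀ v, IsISG n v → ∀ i : Fin n, NullPlayer n v i → Φ v i = 0

/-- The transfer property of a power index. -/
def Transfer (n : ℕ) (Φ : ((Fin n → ℝ) → ℝ) → Fin n → ℝ) : Prop :=
  ∀ u v, IsISG n u → IsISG n v → ∀ i : Fin n,
    Φ u i + Φ v i = Φ (fun x => max (u x) (v x)) i + Φ (fun x => min (u x) (v x)) i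
/-- The density-weighted variant `Ψ^f` of the Shapley–Shubik index. -/
noncomputable def PsiF (n : ℕ) (f : (Fin n → ℝ) → ℝ) (v : (Fin n → ℝ) → ℝ) (i : Fin n) : ℝ :=
  (1 / (n.factorial : ℝ)) * ∑ π : Equiv.Perm (Fin n),
    ∫ x in cube n,
      f x *
        ((v (fun j => if π j < π i then x j else 1) -
          v (fun j => if π j < π i then x j else 0)) -
         (v (fun j => if π j ≤ π i then x j else 1) -
          v (fun j => if π j ≤ π i then x j else 0)))

/-- The remaining uncertainty about the value of `v` once the coordinates satisfying `p` are fixed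
to those of `x`: the difference between setting all other coordinates to `1` and to `0`. -/
def uncertainty {n : ℕ} (v : (Fin n → ℝ) → ℝ) (p : Fin n → Prop) [DecidablePred p]
    (x : Fin n → ℝ) : ℝ :=
  v (fun j => if p j then x j else 1) - v (fun j => if p j then x j else 0)

theorem PsiF_eq_sum_uncertainty (n : ℕ) (f v : (Fin n → ℝ) → ℝ) (i : Fin n) :
    PsiF n f v i = (1 / (n.factorial : ℝ)) * ∑ π : Equiv.Perm (Fin n), ∫ x in cube n,
      f x * (uncertainty v (fun j => π j < π i) x - uncertainty v (fun j => π j ≤ π i) x) :=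
  rfl

theorem measurableSet_cube (n : ℕ) : MeasurableSet (cube n) := by
  have h : cube n = Set.univ.pi fun _ => Set.Icc (0 : ℝ) 1 := by
    ext
    simp only [cube, Set.mem_ofPred, Set.mem_univ_pi]
  rw [h]
  exact MeasurableSet.univ_pi fun _ => measurableSet_Icc

theorem ite_mem_cube {n : ℕ} (p : Fin n → Prop) [DecidablePred p] {x : Fin n → ℝ}
    (hx : x ∈ cube n) {c : ℝ} (hc : c ∈ Set.Icc (0 : ℝ) 1) :
    (fun j => if p j then x j else c) ∈ cube n := by
  intro j
  dsimp only
  split_ifs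
  · exact hx j
  · exact hc

theorem comp_perm_mem_cube_iff {n : ℕ} (π : Equiv.Perm (Fin n)) {x : Fin n → ℝ} :
    (fun j => x (π j)) ∈ cube n ↔ x ∈ cube n :=
  π.forall_congr_left.trans (by simp [cube])

/-- Monotone functions of several real variables are Lebesgue measurable. -/
theorem Monotone.aemeasurable_pi {ι : Type*} [Fintype ι] {g : (ι → ℝ) → ℝ} (hg : Monotone g) :
    AEMeasurable g := by
  refine NullMeasurable.aemeasurable ?_
  have h : @Measurable (NullMeasurableSpace (ι → ℝ) volume) ℝ _ _ g :=
    measurable_of_Ioi fun a =>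
      ((isUpperSet_Ioi a).preimage hg).ordConnected.nullMeasurableSet
  exact fun s hs => h hs

theorem MonotoneOn.aemeasurable_cube {n : ℕ} {g : (Fin n → ℝ) → ℝ} (hg : MonotoneOn g (cube n)) :
    AEMeasurable g (volume.restrict (cube n)) := by
  have hclamp (x : Fin n → ℝ) : (fun i => max 0 (min 1 (x i))) ∈ cube n :=
    fun i => ⟨le_max_left _ _, max_le zero_le_one (min_le_left _ _)⟩
  have hmono : Monotone fun x : Fin n → ℝ => g fun i => max 0 (min 1 (x i)) := by
    intro x y hxy
    refine hg (hclamp x) (hclamp y) fun i => ?_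
    exact max_le_max le_rfl (min_le_min le_rfl (hxy i))
  refine hmono.aemeasurable_pi.restrict.congr ?_
  filter_upwards [ae_restrict_mem (measurableSet_cube n)] with x hx
  congr 1
  ext i
  rw [min_eq_right (hx i).2, max_eq_right (hx i).1]

namespace IsISG

variable {n : ℕ} {u v : (Fin n → ℝ) → ℝ}

theorem max (hu : IsISG n u) (hv : IsISG n v) : IsISG n fun x => max (u x) (v x) := by
  obtain ⟨hu0, hu1, hur, hum⟩ := hu
  obtain ⟨hv0, hv1, hvr, hvm⟩ := hv
  refine ⟨by simp [hu0, hv0], by simp [hu1, hv1], fun x hx => ⟨?_, ?_⟩, fun x hx y hy h => ?_⟩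
  · exact le_max_of_le_left (hur x hx).1
  · exact max_le (hur x hx).2 (hvr x hx).2
  · exact max_le_max (hum x hx y hy h) (hvm x hx y hy h)

theorem min (hu : IsISG n u) (hv : IsISG n v) : IsISG n fun x => min (u x) (v x) := by
  obtain ⟨hu0, hu1, hur, hum⟩ := hu
  obtain ⟨hv0, hv1, hvr, hvm⟩ := hv
  refine ⟨by simp [hu0, hv0], by simp [hu1, hv1], fun x hx => ⟨?_, ?_⟩, fun x hx y hy h => ?_⟩
  · exact le_min (hur x hx).1 (hvr x hx).1
  · exact min_le_of_left_le (hur x hx).2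
  · exact min_le_min (hum x hx y hy h) (hvm x hx y hy h)

theorem aestronglyMeasurable_ite (hv : IsISG n v) (p : Fin n → Prop) [DecidablePred p] {c : ℝ}
    (hc : c ∈ Set.Icc (0 : ℝ) 1) :
    AEStronglyMeasurable (fun x : Fin n → ℝ => v fun j => if p j then x j else c)
      (volume.restrict (cube n)) := by
  refine (MonotoneOn.aemeasurable_cube fun x hx y hy hxy => ?_).aestronglyMeasurable
  refine hv.2.2.2 _ (ite_mem_cube p hx hc) _ (ite_mem_cube p hy hc) fun j => ?_
  split_ifs
  · exact hxy j
  · exact le_rfl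

theorem uncertainty_mem_Icc (hv : IsISG n v) (p : Fin n → Prop) [DecidablePred p]
    {x : Fin n → ℝ} (hx : x ∈ cube n) : uncertainty v p x ∈ Set.Icc (0 : ℝ) 1 := by
  have h1 := ite_mem_cube p hx (c := 1) (by simp)
  have h0 := ite_mem_cube p hx (c := 0) (by simp)
  have hle := hv.2.2.2 _ h0 _ h1 fun j => by split_ifs <;> simp
  have hr1 := hv.2.2.1 _ h1
  have hr0 := hv.2.2.1 _ h0
  unfold uncertainty
  constructor <;> linarith [hr1.2, hr0.1]

theorem uncertainty_anti (hv : IsISG n v) {p q : Fin n → Prop} [DecidablePred p]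
    [DecidablePred q] (hpq : ∀ j, p j → q j) {x : Fin n → ℝ} (hx : x ∈ cube n) :
    uncertainty v q x ≤ uncertainty v p x := by
  refine sub_le_sub (hv.2.2.2 _ (ite_mem_cube q hx (by simp)) _ (ite_mem_cube p hx (by simp))
    fun j => ?_) (hv.2.2.2 _ (ite_mem_cube p hx (by simp)) _ (ite_mem_cube q hx (by simp))
    fun j => ?_)
  all_goals
    have hj := hx j
    by_cases hp : p j
    · simp [hp, hpq j hp]
    · by_cases hq : q j <;> simp [hp, hq, hj.1, hj.2]

theorem integrableOn_mul_uncertainty (hv : IsISG n v) {f : (Fin n → ℝ) → ℝ}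
    (hf : IntegrableOn f (cube n)) (p : Fin n → Prop) [DecidablePred p] :
    IntegrableOn (fun x => f x * uncertainty v p x) (cube n) := by
  refine Integrable.mul_bdd (c := 1) hf
    ((hv.aestronglyMeasurable_ite p (by simp)).sub (hv.aestronglyMeasurable_ite p (by simp))) ?_
  filter_upwards [ae_restrict_mem (measurableSet_cube n)] with x hx
  have h := hv.uncertainty_mem_Icc p hx
  rw [Real.norm_of_nonneg h.1]
  exact h.2

theorem integrableOn_mul_uncertainty_sub (hv : IsISG n v) {f : (Fin n → ℝ) → ℝ}
    (hf : IntegrableOn f (cube n)) (p q : Fin n → Prop) [DecidablePred p] [DecidablePred q] :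
    IntegrableOn (fun x => f x * (uncertainty v p x - uncertainty v q x)) (cube n) := by
  simp only [mul_sub]
  exact (hv.integrableOn_mul_uncertainty hf p).sub (hv.integrableOn_mul_uncertainty hf q)

/-- The reductions of uncertainty along an ordering of the players add up to one. -/
theorem sum_uncertainty_sub (hv : IsISG n v) (π : Equiv.Perm (Fin n)) (x : Fin n → ℝ) :
    ∑ i, (uncertainty v (fun j => π j < π i) x - uncertainty v (fun j => π j ≤ π i) x) = 1 := by
  let T (m : ℕ) : ℝ := uncertainty v (fun j => (π j : ℕ) < m) x
  have hterm (i : Fin n) :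
      uncertainty v (fun j => π j < π i) x - uncertainty v (fun j => π j ≤ π i) x =
        T (π i) - T (π i + 1) := by
    simp only [T, uncertainty, Fin.lt_def, Fin.le_def, Nat.lt_succ_iff]
  have hT0 : T 0 = 1 := by simp [T, uncertainty, hv.1, hv.2.1]
  have hTn : T n = 0 := by simp [T, uncertainty]
  simp only [hterm]
  rw [Equiv.sum_comp π fun k : Fin n => T k - T (k + 1),
    Fin.sum_univ_eq_sum_range (fun k => T k - T (k + 1)) n, Finset.sum_range_sub', hT0, hTn,
    sub_zero]

end IsISG

section PowerIndex

variable {n : ℕ} {f : (Fin n → ℝ) → ℝ}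

theorem PsiF_nonneg (hf : ∀ x ∈ cube n, 0 ≤ f x) {v : (Fin n → ℝ) → ℝ} (hv : IsISG n v)
    (i : Fin n) : 0 ≤ PsiF n f v i := by
  rw [PsiF_eq_sum_uncertainty]
  refine mul_nonneg (by positivity) (Finset.sum_nonneg fun π _ => ?_)
  refine setIntegral_nonneg (measurableSet_cube n) fun x hx => ?_
  exact mul_nonneg (hf x hx) (sub_nonneg.2 (hv.uncertainty_anti (fun _ => le_of_lt) hx))

theorem efficient_PsiF (hint : ∫ x in cube n, f x = 1) : Efficient n (PsiF n f) := by
  intro v hv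
  have hf : IntegrableOn f (cube n) := integrable_of_integral_eq_one hint
  simp only [PsiF_eq_sum_uncertainty]
  rw [← Finset.mul_sum, Finset.sum_comm]
  have hπ (π : Equiv.Perm (Fin n)) : ∑ i, ∫ x in cube n,
      f x * (uncertainty v (fun j => π j < π i) x - uncertainty v (fun j => π j ≤ π i) x) = 1 := by
    rw [← integral_finsetSum _ fun i _ => hv.integrableOn_mul_uncertainty_sub hf _ _]
    simp only [← Finset.mul_sum, hv.sum_uncertainty_sub, mul_one, hint]
  simp only [hπ, Finset.sum_const, Finset.card_univ, Fintype.card_perm, Fintype.card_fin,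
    nsmul_eq_mul, mul_one]
  exact one_div_mul_cancel (by positivity)

theorem positive_PsiF (hf : ∀ x ∈ cube n, 0 ≤ f x) (hint : ∫ x in cube n, f x = 1) :
    Positive n (PsiF n f) := by
  refine fun v hv => ⟨fun h0 => ?_, PsiF_nonneg hf hv⟩
  simpa [h0] using efficient_PsiF hint v hv

theorem setIntegral_cube_comp_perm (π : Equiv.Perm (Fin n)) (g : (Fin n → ℝ) → ℝ) :
    ∫ x in cube n, g (fun j => x (π j)) = ∫ x in cube n, g x := by
  have hmp := volume_measurePreserving_piCongrLeft (fun _ : Fin n => ℝ) π.symm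
  have happ (x : Fin n → ℝ) :
      MeasurableEquiv.piCongrLeft (fun _ : Fin n => ℝ) π.symm x = fun j => x (π j) := by
    ext j
    simpa [MeasurableEquiv.coe_piCongrLeft] using
      Equiv.piCongrLeft_apply_apply (fun _ : Fin n => ℝ) π.symm x (π j)
  have hpre : MeasurableEquiv.piCongrLeft (fun _ : Fin n => ℝ) π.symm ⁻¹' cube n = cube n := by
    ext x
    rw [Set.mem_preimage, happ, comp_perm_mem_cube_iff]
  have h := hmp.setIntegral_preimage_emb (MeasurableEquiv.measurableEmbedding _) g (cube n)
  simpa only [hpre, happ] using h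

theorem anonymous_PsiF
    (hsym : ∀ x ∈ cube n, ∀ π : Equiv.Perm (Fin n), f (fun i => x (π i)) = f x) :
    Anonymous n (PsiF n f) := by
  intro v _ π i
  simp only [PsiF_eq_sum_uncertainty]
  congr 1
  refine Fintype.sum_equiv (Equiv.mulRight π) _ _ fun σ => ?_
  refine Eq.trans ?_ (setIntegral_cube_comp_perm π _)
  refine setIntegral_congr_fun (measurableSet_cube n) fun x hx => ?_
  simp only [hsym x hx π]
  rfl

theorem PsiF_congr {u v : (Fin n → ℝ) → ℝ} (h : Set.EqOn u v (cube n)) (i : Fin n) :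
    PsiF n f u i = PsiF n f v i := by
  simp only [PsiF_eq_sum_uncertainty]
  congr 1
  refine Finset.sum_congr rfl fun π _ => setIntegral_congr_fun (measurableSet_cube n) fun x hx => ?_
  simp only [uncertainty]
  rw [h (ite_mem_cube _ hx (by simp)), h (ite_mem_cube _ hx (by simp)),
    h (ite_mem_cube _ hx (by simp)), h (ite_mem_cube _ hx (by simp))]

theorem Anonymous.symmetricIdx_PsiF (h : Anonymous n (PsiF n f)) :
    SymmetricIdx n (PsiF n f) := by
  intro v hv i j hij
  rw [← h v hv (Equiv.swap i j) i, Equiv.swap_apply_left]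
  exact PsiF_congr hij j

theorem nullPlayerProp_PsiF : NullPlayerProp n (PsiF n f) := by
  intro v _ i hi
  rw [PsiF_eq_sum_uncertainty, Finset.sum_eq_zero, mul_zero]
  intro π _
  refine setIntegral_eq_zero_of_forall_eq_zero fun x hx => ?_
  have key {c : ℝ} (hc : c ∈ Set.Icc (0 : ℝ) 1) :
      v (fun j => if π j < π i then x j else c) = v (fun j => if π j ≤ π i then x j else c) := by
    refine hi _ (ite_mem_cube _ hx hc) _ (ite_mem_cube _ hx hc) fun j hj => ?_
    have hne : π j ≠ π i := π.injective.ne hj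
    simp only [hne.le_iff_lt]
  simp only [uncertainty]
  rw [key (by simp), key (by simp), sub_self, mul_zero]

theorem transfer_PsiF (hf : IntegrableOn f (cube n)) : Transfer n (PsiF n f) := by
  intro u v hu hv i
  simp only [PsiF_eq_sum_uncertainty, ← mul_add, ← Finset.sum_add_distrib]
  congr 1
  refine Finset.sum_congr rfl fun π _ => ?_
  rw [← integral_add (hu.integrableOn_mul_uncertainty_sub hf _ _)
      (hv.integrableOn_mul_uncertainty_sub hf _ _),
    ← integral_add ((hu.max hv).integrableOn_mul_uncertainty_sub hf _ _)
      ((hu.min hv).integrableOn_mul_uncertainty_sub hf _ _)]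
  congr 1
  ext x
  have key (p : Fin n → Prop) [DecidablePred p] :
      uncertainty u p x + uncertainty v p x =
        uncertainty (fun x => max (u x) (v x)) p x + uncertainty (fun x => min (u x) (v x)) p x := by
    simp only [uncertainty]
    linarith [max_add_min (u fun j => if p j then x j else 1) (v fun j => if p j then x j else 1),
      max_add_min (u fun j => if p j then x j else 0) (v fun j => if p j then x j else 0)]
  linear_combination f x * key (fun j => π j < π i) - f x * key (fun j => π j ≤ π i)

end PowerIndex

/-- For every measurable, permutation-symmetric probability density `f`
on `[0,1]^n`, the power index `Ψ^f` is positive, efficient, anonymous, symmetric, and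
satisfies both the null player property and the transfer property on interval simple games. -/
theorem PsiF_properties (n : ℕ) (hn : 1 ≤ n) (f : (Fin n → ℝ) → ℝ)
    (hmeas : Measurable f) (hnonneg : ∀ x ∈ cube n, 0 ≤ f x)
    (hint : ∫ x in cube n, f x = 1)
    (hsym : ∀ x ∈ cube n, ∀ π : Equiv.Perm (Fin n), f (fun i => x (π i)) = f x) :
    Positive n (PsiF n f) ∧ Efficient n (PsiF n f) ∧ Anonymous n (PsiF n f) ∧
    SymmetricIdx n (PsiF n f) ∧ NullPlayerProp n (PsiF n f) ∧ Transfer n (PsiF n f) := by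
  have hanon := anonymous_PsiF hsym
  exact ⟨positive_PsiF hnonneg hint, efficient_PsiF hint, hanon, hanon.symmetricIdx_PsiF,
    nullPlayerProp_PsiF, transfer_PsiF (integrable_of_integral_eq_one hint)⟩
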